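/- For every Mealy-type weighted automaton A = (A,X,Y,σ^A,δ^A,ω^A) over a semiring S there exists a Moore-type weighted automaton B = (B,X,Y,σ^B,δ^B,ω^B) over S such that ⟦A⟧_{n1} = ⟦B⟧_{n1}, i.e. the n1-behavior of A equals the n1-behavior of B as functions (X×Y)* → S, and moreover B can be chosen with |B| ≤ |A|·(|X|+1) and so that simultaneously ⟦A⟧_{1n} = ⟦B⟧_{1n}. (Concretely, B = A ∪ (A×X), with σ^B(a) = σ^A(a) for a ∈ A and σ^B = 0 on A×X; δ^B(a,x,(a,x)) = 1 for a ∈ A, δ^B((a₁,x₁),x,(a₂,x)) = δ^A(a₁,x₁,a₂), and δ^B = 0 in all other cases; ω^B((a,x),y) = ω^A(a,x,y) and ω^B(a,y) = 0 for a ∈ A, works.) -/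

import Mathlib

noncomputable section

open Finset

/-- A sequential weighted automaton over a semiring `S`. -/
structure SeqWA (S A X Y : Type) where
  σ : A → S
  μ : A → X → Y → A → S

/-- A Mealy-type weighted automaton over a semiring `S`. -/
structure MealyWA (S A X Y : Type) where
  σ : A → S
  δ : A → X → A → S
  ω : A → X → Y → S

/-- A Moore-type weighted automaton over a semiring `S`. -/
structure MooreWA (S A X Y : Type) where
  σ : A → S
  δ : A → X → A → S
  ω : A → Y → S

variable {S A X Y : Type} [Semiring S] [Fintype A] [DecidableEq A]

/-- extension of letterwise matrices to words: `μ_ε = 1`, `μ_{wx} = μ_w * μ_x`. -/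
def wordMat {P : Type} (μ : P → Matrix A A S) (w : List P) : Matrix A A S :=
  w.foldl (fun m p => m * μ p) 1

def SeqWA.mat (M : SeqWA S A X Y) (p : X × Y) : Matrix A A S :=
  Matrix.of fun a b => M.μ a p.1 p.2 b

/-- behavior of a sequential weighted automaton. -/
def SeqWA.beh (M : SeqWA S A X Y) (w : List (X × Y)) : S :=
  ∑ a, ∑ b, M.σ a * wordMat M.mat w a b

def MealyWA.δmat (M : MealyWA S A X Y) (x : X) : Matrix A A S :=
  Matrix.of fun a b => M.δ a x b

def MealyWA.ωvec (M : MealyWA S A X Y) (p : X × Y) : A → S :=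
  fun a => M.ω a p.1 p.2

/-- 1n-semantics vectors for a Mealy automaton:
`ω_{ε,ε} = 1`, `ω_{x,y}` as given, and `ω_{xu,yv} = D(ω_{x,y})·δ_x·ω_{u,v}`. -/
def MealyWA.omega1n (M : MealyWA S A X Y) : List (X × Y) → A → S
  | [] => fun _ => 1
  | [p] => fun a => M.ω a p.1 p.2
  | p :: q :: w => fun a => M.ω a p.1 p.2 * ∑ b, M.δ a p.1 b * M.omega1n (q :: w) b

/-- 1n-behavior of a Mealy automaton. -/
def MealyWA.beh1n (M : MealyWA S A X Y) (w : List (X × Y)) : S :=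
  ∑ a, M.σ a * M.omega1n w a

/-- n1-semantics data for a Mealy automaton: the pair `(ω_{u,v}, δ_u)` computed by
`ω_{ε,ε} = 1`, `δ_ε = 1`, `ω_{ux,vy} = D(ω_{u,v})·δ_u·ω_{x,y}` and `δ_{ux} = δ_u·δ_x`. -/
def MealyWA.n1aux (M : MealyWA S A X Y) (w : List (X × Y)) : (A → S) × Matrix A A S :=
  w.foldl (fun st p => (fun a => st.1 a * ∑ b, st.2 a b * M.ω b p.1 p.2, st.2 * M.δmat p.1))
    (fun _ => 1, 1)

/-- n1-behavior of a Mealy automaton. -/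
def MealyWA.behN1 (M : MealyWA S A X Y) (w : List (X × Y)) : S :=
  ∑ a, M.σ a * (M.n1aux w).1 a

/-- the nested sums occurring in the sequential semantics of a Mealy automaton. -/
def MealyWA.sAux (M : MealyWA S A X Y) : List (X × Y) → A → S
  | [] => fun _ => 1
  | p :: w => fun a => M.ω a p.1 p.2 * ∑ b, M.δ a p.1 b * M.sAux w b

/-- s-behavior (sequential semantics) of a Mealy automaton. -/
def MealyWA.behS (M : MealyWA S A X Y) (w : List (X × Y)) : S :=
  ∑ a, M.σ a * M.sAux w a

def MooreWA.δmat (M : MooreWA S A X Y) (x : X) : Matrix A A S :=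
  Matrix.of fun a b => M.δ a x b

/-- 1n-semantics vectors for a Moore automaton:
`ω_{ε,ε} = 1` and `ω_{xu,yv} = δ_x·D(ω_y)·ω_{u,v}`. -/
def MooreWA.omega1n (M : MooreWA S A X Y) : List (X × Y) → A → S
  | [] => fun _ => 1
  | p :: w => fun a => ∑ b, M.δ a p.1 b * (M.ω b p.2 * M.omega1n w b)

/-- 1n-behavior of a Moore automaton. -/
def MooreWA.beh1n (M : MooreWA S A X Y) (w : List (X × Y)) : S :=
  ∑ a, M.σ a * M.omega1n w a

/-- n1-semantics data for a Moore automaton: the pair `(ω_{u,v}, δ_u)` computed by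
`ω_{ε,ε} = 1`, `δ_ε = 1`, `ω_{ux,vy} = D(ω_{u,v})·δ_{ux}·ω_y` and `δ_{ux} = δ_u·δ_x`. -/
def MooreWA.n1aux (M : MooreWA S A X Y) (w : List (X × Y)) : (A → S) × Matrix A A S :=
  w.foldl (fun st p =>
      (fun a => st.1 a * ∑ b, (st.2 * M.δmat p.1) a b * M.ω b p.2, st.2 * M.δmat p.1))
    (fun _ => 1, 1)

/-- n1-behavior of a Moore automaton. -/
def MooreWA.behN1 (M : MooreWA S A X Y) (w : List (X × Y)) : S :=
  ∑ a, M.σ a * (M.n1aux w).1 a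

open Classical in
/-- The Moore automaton that delays the output of a Mealy automaton by remembering, in its states
`A × X`, the last letter read together with the state it was read in. -/
def MealyWA.toMoore (M : MealyWA S A X Y) : MooreWA S (A ⊕ A × X) X Y where
  σ := Sum.elim M.σ fun _ => 0
  δ
    | .inl a, x, .inr (b, z) => if a = b ∧ z = x then 1 else 0
    | .inr (a, t), x, .inr (b, z) => if z = x then M.δ a t b else 0
    | _, _, .inl _ => 0
  ω := Sum.elim (fun _ _ => 0) fun p y => M.ω p.1 p.2 y

open Classical in
theorem MealyWA.mul_omega1n_toMoore [Fintype X] (M : MealyWA S A X Y) (p : X × Y)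
    (w : List (X × Y)) (a : A) :
    M.ω a p.1 p.2 * M.toMoore.omega1n w (.inr (a, p.1)) = M.omega1n (p :: w) a := by
  induction w generalizing p a with
  | nil => simp [MooreWA.omega1n, MealyWA.omega1n]
  | cons q w ih =>
    simp [MooreWA.omega1n, MealyWA.omega1n, ← ih, MealyWA.toMoore, Fintype.sum_prod_type]

open Classical in
theorem MealyWA.omega1n_toMoore_inl [Fintype X] (M : MealyWA S A X Y) (w : List (X × Y)) (a : A) :
    M.toMoore.omega1n w (.inl a) = M.omega1n w a := by
  cases w with
  | nil => simp [MooreWA.omega1n, MealyWA.omega1n]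
  | cons p w =>
    rw [← M.mul_omega1n_toMoore]
    simp [MooreWA.omega1n, MealyWA.toMoore, Fintype.sum_prod_type, ite_and]

open Classical in
theorem MealyWA.n1aux_toMoore_snd_mul [Fintype X] (M : MealyWA S A X Y) (w : List (X × Y)) (x : X)
    (a : A) (d : A ⊕ A × X) :
    ((M.toMoore.n1aux w).2 * M.toMoore.δmat x) (.inl a) d =
      Sum.elim (fun _ => 0) (fun q => if q.2 = x then (M.n1aux w).2 a q.1 else 0) d := by
  induction w using List.reverseRecOn generalizing x d with
  | nil =>
    rcases d with c | ⟨c, z⟩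
    · simp [MooreWA.n1aux, MooreWA.δmat, MealyWA.toMoore]
    · by_cases h : z = x <;>
        simp [MooreWA.n1aux, MealyWA.n1aux, MooreWA.δmat, MealyWA.toMoore, Matrix.one_apply, h]
  | append_singleton w p ih =>
    have hB : (M.toMoore.n1aux (w ++ [p])).2 =
        (M.toMoore.n1aux w).2 * M.toMoore.δmat p.1 := by
      simp [MooreWA.n1aux]
    have hA : (M.n1aux (w ++ [p])).2 = (M.n1aux w).2 * M.δmat p.1 := by
      simp [MealyWA.n1aux]
    rw [hB, hA, Matrix.mul_apply]
    simp only [ih]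
    rcases d with c | ⟨c, z⟩
    · simp [MooreWA.δmat, MealyWA.toMoore]
    · by_cases h : z = x <;>
        simp [MooreWA.δmat, MealyWA.δmat, MealyWA.toMoore, Matrix.mul_apply,
          Fintype.sum_prod_type, h]

open Classical in
theorem MealyWA.n1aux_toMoore_fst_inl [Fintype X] (M : MealyWA S A X Y) (w : List (X × Y)) (a : A) :
    (M.toMoore.n1aux w).1 (.inl a) = (M.n1aux w).1 a := by
  induction w using List.reverseRecOn with
  | nil => simp [MooreWA.n1aux, MealyWA.n1aux]
  | append_singleton w p ih =>
    have hB : (M.toMoore.n1aux (w ++ [p])).1 (.inl a) = (M.toMoore.n1aux w).1 (.inl a) *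
        ∑ b, ((M.toMoore.n1aux w).2 * M.toMoore.δmat p.1) (.inl a) b * M.toMoore.ω b p.2 := by
      simp [MooreWA.n1aux]
    have hA : (M.n1aux (w ++ [p])).1 a =
        (M.n1aux w).1 a * ∑ b, (M.n1aux w).2 a b * M.ω b p.1 p.2 := by
      simp [MealyWA.n1aux]
    rw [hB, hA, ih]
    simp only [n1aux_toMoore_snd_mul]
    simp [MealyWA.toMoore, Fintype.sum_prod_type]

/-- every Mealy-type weighted automaton is n1-equivalent (and simultaneously
1n-equivalent) to a Moore-type weighted automaton with at most `|A|·(|X|+1)` states. -/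
theorem stmt7 {S A X Y : Type} [Semiring S] [Fintype A] [DecidableEq A] [Nonempty A]
    [Fintype X] [Nonempty X] [Fintype Y] [Nonempty Y]
    (M : MealyWA S A X Y) :
    ∃ (B : Type) (_ : Fintype B) (_ : DecidableEq B) (_ : Nonempty B)
      (N : MooreWA S B X Y), M.behN1 = N.behN1 ∧ M.beh1n = N.beh1n ∧
        Fintype.card B ≤ Fintype.card A * (Fintype.card X + 1) := by
  classical
  refine ⟨A ⊕ A × X, inferInstance, inferInstance, inferInstance, M.toMoore, ?_, ?_, ?_⟩
  · funext w
    simp only [MealyWA.behN1, MooreWA.behN1, Fintype.sum_sum_type, M.n1aux_toMoore_fst_inl]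
    simp [MealyWA.toMoore]
  · funext w
    simp only [MealyWA.beh1n, MooreWA.beh1n, Fintype.sum_sum_type, M.omega1n_toMoore_inl]
    simp [MealyWA.toMoore]
  · simp [mul_add, add_comm]
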